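/- Let G be a group and H ≤ G a subgroup of finite index. Suppose there exist an injective group homomorphism φ : H → Homeo(C) with φ(h) a prefix-exchange homeomorphism for every h ∈ H, and a finite binary word a such that for all h₁, h₂ ∈ H, φ(h₁)(a*) ∩ φ(h₂)(a*) ≠ ∅ if and only if h₁ = h₂ (i.e., the cylinder a* is a demonstration node for φ). Then there exist an injective group homomorphism ψ : G → Homeo(C) with ψ(g) a prefix-exchange homeomorphism for every g ∈ G, and a finite binary word w such that for all g₁, g₂ ∈ G, ψ(g₁)(w*) ∩ ψ(g₂)(w*) ≠ ∅ if and only if g₁ = g₂. (In other words, if H embeds as a demonstrative subgroup of Thompson's group V with a demonstration node, and [G:H] < ∞, then G embeds as a demonstrative subgroup of V with a demonstration node.) -/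

import Mathlib

/-- The Cantor space `C = ℕ → Bool` with the product topology. -/
abbrev Cantor : Type := ℕ → Bool

/-- The sequence `u · y` beginning with the letters of the finite word `u` and
continuing with `y`. -/
def appendSeq (u : List Bool) (y : Cantor) : Cantor :=
  fun n => if h : n < u.length then u.get ⟨n, h⟩ else y (n - u.length)

/-- The cylinder `u*`: all sequences of the form `u · y`. -/
def cylinder (u : List Bool) : Set Cantor :=
  Set.range (appendSeq u)

/-- The group of homeomorphisms of the Cantor space, with composition as
multiplication (`(f * g) x = f (g x)`). -/
instance : Group (Cantor ≃ₜ Cantor) where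
  mul f g := g.trans f
  one := Homeomorph.refl _
  inv := Homeomorph.symm
  mul_assoc _ _ _ := Homeomorph.ext fun _ => rfl
  one_mul _ := Homeomorph.ext fun _ => rfl
  mul_one _ := Homeomorph.ext fun _ => rfl
  inv_mul_cancel f := Homeomorph.ext fun x => f.symm_apply_apply x

/-- A homeomorphism of the Cantor space is a prefix-exchange homeomorphism if it is
given by finitely many prefix substitutions `uᵢ · y ↦ vᵢ · y`, where the cylinders
`uᵢ*` partition `C` and the cylinders `vᵢ*` partition `C`. -/
def IsPrefixExchange (f : Cantor ≃ₜ Cantor) : Prop :=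
  ∃ n : ℕ, 1 ≤ n ∧ ∃ u v : Fin n → List Bool,
    (Set.univ : Set (Fin n)).PairwiseDisjoint (fun i => cylinder (u i)) ∧
    (⋃ i, cylinder (u i)) = Set.univ ∧
    (Set.univ : Set (Fin n)).PairwiseDisjoint (fun i => cylinder (v i)) ∧
    (⋃ i, cylinder (v i)) = Set.univ ∧
    ∀ (i : Fin n) (y : Cantor), f (appendSeq (u i) y) = appendSeq (v i) y


theorem appendSeq_nil (y : Cantor) : appendSeq [] y = y := by
  funext n
  simp [appendSeq]

theorem appendSeq_append (u v : List Bool) (y : Cantor) :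
    appendSeq (u ++ v) y = appendSeq u (appendSeq v y) := by
  funext n
  simp only [appendSeq, List.length_append, List.get_eq_getElem]
  by_cases hu : n < u.length
  · have : n < u.length + v.length := by omega
    simp [hu, this]
  · by_cases hv : n < u.length + v.length
    · have : n - u.length < v.length := by omega
      simp [hu, hv, this, List.getElem_append]
    · have : ¬ n - u.length < v.length := by omega
      simp [hu, hv, this, Nat.sub_sub]

theorem appendSeq_cons_zero (b : Bool) (u : List Bool) (y : Cantor) :
    appendSeq (b :: u) y 0 = b := by
  simp [appendSeq]

theorem appendSeq_singleton_tail (x : Cantor) : appendSeq [x 0] (fun n => x (n + 1)) = x := by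
  funext n
  cases n <;> simp [appendSeq]

theorem appendSeq_injective (u : List Bool) : Function.Injective (appendSeq u) := by
  intro x y h
  funext n
  simpa [appendSeq] using congrFun h (n + u.length)

theorem continuous_appendSeq (u : List Bool) : Continuous (appendSeq u) := by
  refine continuous_pi fun n => ?_
  by_cases h : n < u.length
  · simpa only [appendSeq, h, dite_true] using continuous_const
  · simpa only [appendSeq, h, dite_false] using continuous_apply _

/-- A family of words is a complete prefix code if every sequence begins with exactly one of
its words. -/
def IsPrefixCode {ι : Type*} (u : ι → List Bool) : Prop :=
  Function.Bijective fun p : ι × Cantor => appendSeq (u p.1) p.2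

theorem isPrefixCode_iff {ι : Type*} {u : ι → List Bool} :
    IsPrefixCode u ↔ (Set.univ : Set ι).PairwiseDisjoint (fun i => cylinder (u i)) ∧
      (⋃ i, cylinder (u i)) = Set.univ := by
  constructor
  · intro h
    refine ⟨fun i _ j _ hij => Set.disjoint_left.2 ?_, Set.eq_univ_of_forall fun x => ?_⟩
    · rintro _ ⟨y, rfl⟩ ⟨z, hz⟩
      exact hij (congrArg Prod.fst (@h.1 (j, z) (i, y) hz)).symm
    · obtain ⟨⟨i, y⟩, rfl⟩ := h.2 x
      exact Set.mem_iUnion.2 ⟨i, y, rfl⟩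
  · rintro ⟨hd, hc⟩
    refine ⟨?_, fun x => ?_⟩
    · rintro ⟨i, y⟩ ⟨j, z⟩ h
      obtain rfl : i = j := by
        by_contra hij
        exact Set.disjoint_left.1 (hd (Set.mem_univ i) (Set.mem_univ j) hij) ⟨y, rfl⟩ ⟨z, h.symm⟩
      exact congrArg (Prod.mk i) (appendSeq_injective (u i) h)
    · obtain ⟨i, y, rfl⟩ := Set.mem_iUnion.1 (hc.symm ▸ Set.mem_univ x)
      exact ⟨(i, y), rfl⟩

theorem IsPrefixCode.comp_equiv {ι κ : Type*} {u : ι → List Bool} (hu : IsPrefixCode u)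
    (e : κ ≃ ι) : IsPrefixCode (u ∘ e) :=
  hu.comp (e.prodCongr (Equiv.refl Cantor)).bijective

theorem IsPrefixCode.sigma {ι : Type*} {κ : ι → Type*} {u : ι → List Bool}
    {v : ∀ i, κ i → List Bool} (hu : IsPrefixCode u) (hv : ∀ i, IsPrefixCode (v i)) :
    IsPrefixCode fun s : Σ i, κ i => u s.1 ++ v s.1 s.2 := by
  constructor
  · rintro ⟨⟨i, k⟩, y⟩ ⟨⟨j, l⟩, z⟩ h
    simp only [appendSeq_append] at h
    have h' := @hu.1 (i, _) (j, _) h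
    obtain rfl : i = j := congrArg Prod.fst h'
    have h'' := @(hv i).1 (k, y) (l, z) (congrArg Prod.snd h')
    simp only [Prod.mk.injEq] at h''
    rw [h''.1, h''.2]
  · intro x
    obtain ⟨⟨i, x⟩, rfl⟩ := hu.2 x
    obtain ⟨⟨k, y⟩, rfl⟩ := (hv i).2 x
    exact ⟨(⟨i, k⟩, y), appendSeq_append _ _ _⟩

theorem isPrefixCode_const_nil {ι : Type*} [Unique ι] :
    IsPrefixCode fun _ : ι => ([] : List Bool) := by
  refine ⟨?_, fun x => ⟨(default, x), appendSeq_nil x⟩⟩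
  rintro ⟨i, y⟩ ⟨j, z⟩ h
  simp only [appendSeq_nil] at h
  rw [h, Subsingleton.elim i j]

theorem IsPrefixCode.option {ι : Type*} {u : ι → List Bool} (hu : IsPrefixCode u) :
    IsPrefixCode fun o : Option ι => o.elim [false] fun i => true :: u i := by
  have hcons (i : ι) (y : Cantor) : appendSeq (true :: u i) y = appendSeq [true]
      (appendSeq (u i) y) := appendSeq_append [true] (u i) y
  constructor
  · rintro ⟨_ | i, y⟩ ⟨_ | j, z⟩ h
    · exact congrArg (Prod.mk none) (appendSeq_injective [false] h)
    · simpa [appendSeq_cons_zero] using congrFun h 0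
    · simpa [appendSeq_cons_zero] using congrFun h 0
    · simp only [Option.elim, hcons] at h
      have h' := @hu.1 (i, y) (j, z) (appendSeq_injective _ h)
      simp only [Prod.mk.injEq] at h'
      rw [h'.1, h'.2]
  · intro x
    have hx := appendSeq_singleton_tail x
    cases h0 : x 0 with
    | false => exact ⟨(none, fun n => x (n + 1)), by rwa [h0] at hx⟩
    | true =>
      obtain ⟨⟨i, y⟩, hy⟩ := hu.2 fun n => x (n + 1)
      refine ⟨(some i, y), ?_⟩
      rw [h0, ← hy] at hx
      exact (hcons i y).trans hx

theorem exists_isPrefixCode (ι : Type*) [Finite ι] [Nonempty ι] :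
    ∃ u : ι → List Bool, IsPrefixCode u := by
  suffices Nonempty ι → ∃ u : ι → List Bool, IsPrefixCode u from this ‹_›
  refine Finite.induction_empty_option
    (P := fun κ => Nonempty κ → ∃ u : κ → List Bool, IsPrefixCode u) ?_ ?_ ?_ ι
  · intro α β e ih hβ
    obtain ⟨u, hu⟩ := ih (e.nonempty_congr.2 hβ)
    exact ⟨_, hu.comp_equiv e.symm⟩
  · rintro ⟨⟨⟩⟩
  · intro α _ ih _
    cases isEmpty_or_nonempty α with
    | inl _ => exact ⟨_, isPrefixCode_const_nil⟩
    | inr h =>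
      obtain ⟨u, hu⟩ := ih h
      exact ⟨_, hu.option⟩

/-- The homeomorphism from `ι × C` to `C` given by a finite complete prefix code. -/
noncomputable def IsPrefixCode.homeomorph {ι : Type*} [Finite ι] [TopologicalSpace ι]
    [DiscreteTopology ι] {u : ι → List Bool} (hu : IsPrefixCode u) : ι × Cantor ≃ₜ Cantor :=
  Continuous.homeoOfEquivCompactToT2 (f := Equiv.ofBijective _ hu)
    (continuous_prod_of_discrete_left.2 fun i => continuous_appendSeq (u i))

theorem IsPrefixCode.homeomorph_apply {ι : Type*} [Finite ι] [TopologicalSpace ι]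
    [DiscreteTopology ι] {u : ι → List Bool} (hu : IsPrefixCode u) (i : ι) (y : Cantor) :
    hu.homeomorph (i, y) = appendSeq (u i) y :=
  rfl

theorem IsPrefixCode.isPrefixExchange {ι : Type*} [Finite ι] {u v : ι → List Bool}
    (hu : IsPrefixCode u) {f : Cantor ≃ₜ Cantor}
    (hf : ∀ i y, f (appendSeq (u i) y) = appendSeq (v i) y) : IsPrefixExchange f := by
  obtain ⟨n, ⟨e⟩⟩ := Finite.exists_equiv_fin ι
  have hv : IsPrefixCode v := by
    have h := f.bijective.comp hu
    simpa only [IsPrefixCode, Function.comp_def, hf] using h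
  obtain ⟨⟨i, -⟩, -⟩ := hu.2 fun _ => false
  have hu' := isPrefixCode_iff.1 (hu.comp_equiv e.symm)
  have hv' := isPrefixCode_iff.1 (hv.comp_equiv e.symm)
  exact ⟨n, (Nat.zero_le _).trans_lt (e i).isLt, _, _, hu'.1, hu'.2, hv'.1, hv'.2,
    fun i y => hf (e.symm i) y⟩

theorem IsPrefixExchange.exists_isPrefixCode {f : Cantor ≃ₜ Cantor} (hf : IsPrefixExchange f) :
    ∃ (n : ℕ) (u v : Fin n → List Bool), IsPrefixCode u ∧
      ∀ i y, f (appendSeq (u i) y) = appendSeq (v i) y := by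
  obtain ⟨n, -, u, v, hd, hc, -, -, h⟩ := hf
  exact ⟨n, u, v, isPrefixCode_iff.2 ⟨hd, hc⟩, h⟩

section Induced

variable {G : Type*} [Group G] (H : Subgroup G)

/-- The element `h` of `H` with `g * t = t' * h`, where `t` and `t'` are the chosen
representatives of the cosets `q` and `g • q`. -/
noncomputable def cosetCocycle (g : G) (q : G ⧸ H) : H :=
  ⟨(g • q).out⁻¹ * (g * q.out), by
    rw [← QuotientGroup.eq, QuotientGroup.out_eq', ← MulAction.Quotient.coe_smul_out]
    rfl⟩

theorem cosetCocycle_one (q : G ⧸ H) : cosetCocycle H 1 q = 1 := by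
  ext
  simp [cosetCocycle]

theorem cosetCocycle_mul (g g' : G) (q : G ⧸ H) :
    cosetCocycle H (g * g') q = cosetCocycle H g (g' • q) * cosetCocycle H g' q := by
  ext
  simp [cosetCocycle, mul_smul, mul_assoc]

theorem eq_of_cosetCocycle_eq {g g' : G} {q : G ⧸ H} (hq : g • q = g' • q)
    (h : cosetCocycle H g q = cosetCocycle H g' q) : g = g' := by
  have h' := congrArg Subtype.val h
  simpa [cosetCocycle, hq] using h'

variable {H} [TopologicalSpace (G ⧸ H)] [DiscreteTopology (G ⧸ H)]

/-- The homeomorphism of `G ⧸ H × C` by which `g` acts in the representation induced from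
`φ`. -/
noncomputable def inducedHomeomorph (φ : H →* (Cantor ≃ₜ Cantor)) (g : G) :
    (G ⧸ H) × Cantor ≃ₜ (G ⧸ H) × Cantor where
  toFun p := (g • p.1, φ (cosetCocycle H g p.1) p.2)
  invFun p := (g⁻¹ • p.1, φ (cosetCocycle H g⁻¹ p.1) p.2)
  left_inv := by
    rintro ⟨q, x⟩
    have h := cosetCocycle_mul H g⁻¹ g q
    rw [inv_mul_cancel, cosetCocycle_one] at h
    refine Prod.ext (inv_smul_smul g q) ?_
    change (φ (cosetCocycle H g⁻¹ (g • q)) * φ (cosetCocycle H g q)) x = x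
    rw [← map_mul, ← h, map_one]
    rfl
  right_inv := by
    rintro ⟨q, x⟩
    have h := cosetCocycle_mul H g g⁻¹ q
    rw [mul_inv_cancel, cosetCocycle_one] at h
    refine Prod.ext (smul_inv_smul g q) ?_
    change (φ (cosetCocycle H g (g⁻¹ • q)) * φ (cosetCocycle H g⁻¹ q)) x = x
    rw [← map_mul, ← h, map_one]
    rfl
  continuous_toFun := continuous_prod_of_discrete_left.2 fun q =>
    (continuous_const (y := g • q)).prodMk (φ (cosetCocycle H g q)).continuous
  continuous_invFun := continuous_prod_of_discrete_left.2 fun q =>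
    (continuous_const (y := g⁻¹ • q)).prodMk (φ (cosetCocycle H g⁻¹ q)).continuous

/-- The representation of `G` induced from `φ`, transported to `C` along a homeomorphism. -/
noncomputable def inducedHom (φ : H →* (Cantor ≃ₜ Cantor))
    (e : (G ⧸ H) × Cantor ≃ₜ Cantor) : G →* (Cantor ≃ₜ Cantor) :=
  MonoidHom.mk' (fun g => (e.symm.trans (inducedHomeomorph φ g)).trans e) fun g g' => by
    refine Homeomorph.ext fun x => ?_
    change e (inducedHomeomorph φ (g * g') (e.symm x)) =
      e (inducedHomeomorph φ g (e.symm (e (inducedHomeomorph φ g' (e.symm x)))))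
    rw [e.symm_apply_apply]
    refine congrArg e (Prod.ext (mul_smul g g' (e.symm x).1) ?_)
    change φ (cosetCocycle H (g * g') _) _ = _
    rw [cosetCocycle_mul, map_mul]
    rfl

theorem inducedHom_apply (φ : H →* (Cantor ≃ₜ Cantor)) (e : (G ⧸ H) × Cantor ≃ₜ Cantor)
    (g : G) (q : G ⧸ H) (x : Cantor) :
    inducedHom φ e g (e (q, x)) = e (g • q, φ (cosetCocycle H g q) x) := by
  change e (inducedHomeomorph φ g (e.symm (e (q, x)))) = _
  rw [e.symm_apply_apply]
  rfl

theorem isPrefixExchange_inducedHom [Finite (G ⧸ H)] {φ : H →* (Cantor ≃ₜ Cantor)}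
    (hφ : ∀ h, IsPrefixExchange (φ h)) {p : G ⧸ H → List Bool} (hp : IsPrefixCode p) (g : G) :
    IsPrefixExchange (inducedHom φ hp.homeomorph g) := by
  choose n u v hu huv using fun q => (hφ (cosetCocycle H g q)).exists_isPrefixCode
  refine (hp.sigma hu).isPrefixExchange (v := fun s => p (g • s.1) ++ v s.1 s.2) ?_
  rintro ⟨q, i⟩ y
  simp only [appendSeq_append]
  rw [← hp.homeomorph_apply, inducedHom_apply, huv, hp.homeomorph_apply]

theorem inducedHom_demonstration_node [Finite (G ⧸ H)] {φ : H →* (Cantor ≃ₜ Cantor)}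
    {a : List Bool}
    (ha : ∀ h₁ h₂ : H, ((φ h₁) '' cylinder a ∩ (φ h₂) '' cylinder a).Nonempty ↔ h₁ = h₂)
    {p : G ⧸ H → List Bool} (hp : IsPrefixCode p) (q : G ⧸ H) (g₁ g₂ : G) :
    ((inducedHom φ hp.homeomorph g₁) '' cylinder (p q ++ a) ∩
      (inducedHom φ hp.homeomorph g₂) '' cylinder (p q ++ a)).Nonempty ↔ g₁ = g₂ := by
  constructor
  · rintro ⟨_, ⟨_, ⟨y, rfl⟩, rfl⟩, _, ⟨z, rfl⟩, h⟩
    rw [appendSeq_append, appendSeq_append, ← hp.homeomorph_apply, ← hp.homeomorph_apply,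
      inducedHom_apply, inducedHom_apply] at h
    obtain ⟨hq, hx⟩ := Prod.mk.inj (hp.homeomorph.injective h)
    exact eq_of_cosetCocycle_eq H hq.symm
      ((ha _ _).1 ⟨_, ⟨_, ⟨y, rfl⟩, rfl⟩, _, ⟨z, rfl⟩, hx⟩)
  · rintro rfl
    rw [Set.inter_self]
    exact (Set.range_nonempty _).image _

end Induced

/-- If a subgroup `H` of finite index in `G` embeds as a demonstrative subgroup of
Thompson's group `V` (realized as the prefix-exchange homeomorphisms of the Cantor
space) with a demonstration node `a*`, then `G` embeds as a demonstrative subgroup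
of `V` with a demonstration node `w*`. -/
theorem finiteIndex_overgroup_demonstrative {G : Type*} [Group G] (H : Subgroup G)
    (hfin : H.FiniteIndex) (φ : H →* (Cantor ≃ₜ Cantor))
    (hφinj : Function.Injective φ)
    (hφpe : ∀ h : H, IsPrefixExchange (φ h))
    (a : List Bool)
    (hdem : ∀ h₁ h₂ : H,
      ((φ h₁) '' cylinder a ∩ (φ h₂) '' cylinder a).Nonempty ↔ h₁ = h₂) :
    ∃ ψ : G →* (Cantor ≃ₜ Cantor),
      Function.Injective ψ ∧ (∀ g : G, IsPrefixExchange (ψ g)) ∧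
      ∃ w : List Bool, ∀ g₁ g₂ : G,
        ((ψ g₁) '' cylinder w ∩ (ψ g₂) '' cylinder w).Nonempty ↔ g₁ = g₂ := by
  let : TopologicalSpace (G ⧸ H) := ⊥
  have : DiscreteTopology (G ⧸ H) := ⟨rfl⟩
  obtain ⟨p, hp⟩ := exists_isPrefixCode (G ⧸ H)
  have hdem' := inducedHom_demonstration_node hdem hp ((1 : G) : G ⧸ H)
  refine ⟨inducedHom φ hp.homeomorph, fun g₁ g₂ h => (hdem' g₁ g₂).1 ?_,
    isPrefixExchange_inducedHom hφpe hp, _, hdem'⟩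
  rw [h]
  exact (hdem' g₂ g₂).2 rfl
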